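/- Let n ≥ d + 2 ≥ 3 and let X be an n×d random matrix with independent N(0,1) entries, and let 𝟙 ∈ ℝⁿ be the all-ones vector. Then XᵀX is invertible almost surely, the random matrix (XᵀX)⁻¹ (Xᵀ𝟙)(Xᵀ𝟙)ᵀ is integrable, and E[(XᵀX)⁻¹ (Xᵀ𝟙)(Xᵀ𝟙)ᵀ] = I_d. Equivalently, E[(XᵀX)⁻¹ Xᵀ (𝟙𝟙ᵀ/n) X β] = β/n for every β ∈ ℝ^d. -/

import Mathlib

open MeasureTheory ProbabilityTheory Matrix
open scoped BigOperators

theorem map_swap_pi_pi {ι κ α : Type*} [Fintype ι] [Fintype κ] [MeasurableSpace α]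
    (γ : Measure α) [IsProbabilityMeasure γ] :
    (Measure.pi fun _ : ι => Measure.pi fun _ : κ => γ).map (fun x j i => x i j)
      = Measure.pi fun _ : κ => Measure.pi fun _ : ι => γ := by
  have h1 := Measure.infinitePi_map_curry_symm (fun (_ : ι) (_ : κ) => γ)
  have h2 := Measure.infinitePi_map_curry (fun (_ : κ) (_ : ι) => γ)
  have h3 := Measure.infinitePi_map_piCongrLeft (X := fun _ : κ × ι => α)
    (fun _ => γ) (Equiv.prodComm ι κ)
  rw [← h1, Measure.map_map (by fun_prop) (by fun_prop)] at h3
  rw [← h3, Measure.map_map (by fun_prop) (by fun_prop)] at h2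
  simp only [Measure.infinitePi_eq_pi] at h2
  rw [← h2]
  congr 1

theorem map_inner_stdGaussian {E ι : Type*} [NormedAddCommGroup E] [InnerProductSpace ℝ E]
    [FiniteDimensional ℝ E] [MeasurableSpace E] [BorelSpace E] [Fintype ι]
    {w : ι → E} (hw : Orthonormal ℝ w) :
    (stdGaussian E).map (fun x i => inner ℝ (w i) x) = Measure.pi fun _ : ι => gaussianReal 0 1 := by
  have key : ((stdGaussian E).map (fun x i => inner ℝ (w i) x)).map (WithLp.toLp 2)
      = stdGaussian (EuclideanSpace ℝ ι) := by
    rw [Measure.map_map (by fun_prop) (by fun_prop)]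
    apply Measure.ext_of_charFun
    ext t
    rw [charFun_stdGaussian, charFun_apply,
      integral_map (Measurable.aemeasurable (by fun_prop)) (by fun_prop)]
    have h : ∀ x : E, inner ℝ ((WithLp.toLp 2 ∘ fun (x : E) i => inner ℝ (w i) x) x) t
        = inner ℝ x (∑ i, t i • w i) := by
      intro x
      simp [PiLp.inner_apply, inner_sum, inner_smul_right, real_inner_comm]
    simp_rw [h]
    rw [← charFun_apply, charFun_stdGaussian]
    have : ‖∑ i, t i • w i‖ ^ 2 = ‖t‖ ^ 2 := by
      rw [← real_inner_self_eq_norm_sq, hw.inner_sum, EuclideanSpace.real_norm_sq_eq]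
      simp [sq]
    rw [← Complex.ofReal_pow, ← Complex.ofReal_pow, this]
  rw [← map_pi_eq_stdGaussian] at key
  exact (MeasurableEquiv.toLp 2 (ι → ℝ)).map_measurableEquiv_injective key

theorem map_toLp_col {ι κ : Type*} [Fintype ι] [Fintype κ] :
    (Measure.pi fun _ : ι => Measure.pi fun _ : κ => gaussianReal 0 1).map
        (fun x j => WithLp.toLp 2 fun i => x i j)
      = Measure.pi fun _ : κ => stdGaussian (EuclideanSpace ℝ ι) := by
  have h := Measure.pi_map_pi (μ := fun _ : κ => Measure.pi fun _ : ι => gaussianReal 0 1)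
    (f := fun _ => WithLp.toLp 2) (fun _ => by fun_prop)
  rw [map_pi_eq_stdGaussian] at h
  rw [← h, ← map_swap_pi_pi, Measure.map_map (by fun_prop) (by fun_prop)]
  rfl

theorem integrable_abs_rpow_gaussianReal {s : ℝ} (hs : -1 < s) :
    Integrable (fun x : ℝ => |x| ^ s) (gaussianReal 0 1) := by
  rw [gaussianReal_of_var_ne_zero 0 one_ne_zero, gaussianPDF_def,
    integrable_withDensity_iff_integrable_smul' (by fun_prop) (by simp)]
  have h : Integrable (fun x : ℝ => |x| ^ s * Real.exp (-(1 / 2) * |x| ^ 2)) := by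
    rw [← integrableOn_univ]
    simpa [-sq_abs, -neg_mul] using (integrable_fun_norm_addHaar (volume : Measure ℝ)
      (f := fun r => r ^ s * Real.exp (-(1 / 2) * r ^ 2))).2
      (by simpa [-neg_mul] using integrableOn_rpow_mul_exp_neg_mul_sq (b := 1 / 2) (by norm_num) hs)
  refine (h.const_mul (√(2 * Real.pi))⁻¹).congr (.of_forall fun x => ?_)
  simp only [ENNReal.toReal_ofReal (gaussianPDFReal_nonneg 0 1 x), smul_eq_mul]
  simp only [gaussianPDFReal, sq_abs, sub_zero, NNReal.coe_one, mul_one]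
  rw [show -(1 / 2) * x ^ 2 = -x ^ 2 / 2 by ring]
  ring

theorem lintegral_prod_abs_rpow_lt_top :
    ∫⁻ y : Fin 3 → ℝ, ENNReal.ofReal (∏ i, |y i| ^ (-(2 / 3) : ℝ))
      ∂(Measure.pi fun _ => gaussianReal 0 1) < ⊤ :=
  (Integrable.fintype_prod fun _ : Fin 3 =>
    integrable_abs_rpow_gaussianReal (s := -(2 / 3)) (by norm_num)).lintegral_lt_top

theorem exists_orthonormal_of_finrank_add_le {E ι : Type*} [NormedAddCommGroup E]
    [InnerProductSpace ℝ E] [FiniteDimensional ℝ E] [Fintype ι] {k : ℕ} (v : ι → E)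
    (h : Fintype.card ι + k ≤ Module.finrank ℝ E) :
    ∃ w : Fin k → E, Orthonormal ℝ w ∧ ∀ i j, inner ℝ (w i) (v j) = 0 := by
  set W := Submodule.span ℝ (Set.range v)
  have h1 : Module.finrank ℝ W ≤ Fintype.card ι := finrank_range_le_card v
  have h2 := W.finrank_add_finrank_orthogonal
  have h3 : k ≤ Module.finrank ℝ Wᗮ := by omega
  refine ⟨fun i => (stdOrthonormalBasis ℝ Wᗮ (Fin.castLE h3 i) : E), ?_, fun i j => ?_⟩
  · exact ((stdOrthonormalBasis ℝ Wᗮ).orthonormal.comp_linearIsometry Wᗮ.subtypeₗᵢ).comp _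
      (Fin.castLE_injective h3)
  · exact W.inner_left_of_mem_orthogonal (Submodule.subset_span (Set.mem_range_self j))
      (stdOrthonormalBasis ℝ Wᗮ (Fin.castLE h3 i)).2

theorem ae_inner_ne_zero_stdGaussian {E : Type*} [NormedAddCommGroup E] [InnerProductSpace ℝ E]
    [FiniteDimensional ℝ E] [MeasurableSpace E] [BorelSpace E] {w : E} (hw : w ≠ 0) :
    ∀ᵐ x ∂(stdGaussian E), inner ℝ w x ≠ 0 := by
  have ho : Orthonormal ℝ (fun _ : Unit => ‖w‖⁻¹ • w) :=
    ⟨fun _ => by simp [norm_smul, hw], fun i j h => (h rfl).elim⟩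
  have := nullSingletonClass_gaussianReal (μ := 0) (one_ne_zero (α := NNReal))
  have h : ∀ᵐ y ∂(Measure.pi fun _ : Unit => gaussianReal 0 1), y () ≠ 0 :=
    Measure.ae_eval_ne (fun _ : Unit => gaussianReal 0 1) () 0
  rw [← map_inner_stdGaussian ho] at h
  filter_upwards [ae_of_ae_map (Measurable.aemeasurable (by fun_prop)) h] with x hx h0
  simp [inner_smul_left, h0] at hx

theorem inv_gram_apply_mul_sq_le {E ι : Type*} [NormedAddCommGroup E] [InnerProductSpace ℝ E]
    [Fintype ι] [DecidableEq ι] (v : ι → E) (a : ι) {u : E}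
    (hu : ∀ b, b ≠ a → inner ℝ u (v b) = 0) :
    (gram ℝ v)⁻¹ a a * inner ℝ u (v a) ^ 2 ≤ ‖u‖ ^ 2 := by
  by_cases hdet : IsUnit (gram ℝ v).det
  swap
  · simp [nonsing_inv_apply_not_isUnit _ hdet]
  set g := (gram ℝ v)⁻¹ with hg
  set y := ∑ c, g c a • v c with hy
  have hpd : (gram ℝ v).PosDef :=
    (posSemidef_gram ℝ v).posDef_iff_det_ne_zero.2 hdet.ne_zero
  have hpos : 0 < g a a := hpd.inv.diag_pos
  have h1 : inner ℝ u y = g a a * inner ℝ u (v a) := by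
    rw [hy, inner_sum, Finset.sum_eq_single a]
    · rw [inner_smul_right]
    · intro b _ hb
      rw [inner_smul_right, hu b hb, mul_zero]
    · simp
  have h2 : ∀ b, inner ℝ (v b) y = (1 : Matrix ι ι ℝ) b a := by
    intro b
    rw [← mul_nonsing_inv _ hdet, hy, inner_sum, mul_apply]
    simp [inner_smul_right, gram_apply, mul_comm, hg]
  have h3 : ‖y‖ ^ 2 = g a a := by
    rw [← real_inner_self_eq_norm_sq]
    nth_rw 1 [hy]
    rw [sum_inner]
    simp [inner_smul_left, h2, one_apply]
  have h4 : inner ℝ u y ^ 2 ≤ ‖u‖ ^ 2 * ‖y‖ ^ 2 := by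
    rw [← mul_pow]
    exact sq_le_sq' (by linarith [neg_le_of_abs_le (abs_real_inner_le_norm u y)])
      (real_inner_le_norm u y)
  rw [h1, h3] at h4
  nlinarith

theorem inv_gram_apply_le_prod {E ι : Type*} [NormedAddCommGroup E] [InnerProductSpace ℝ E]
    [Fintype ι] [DecidableEq ι] (v : ι → E) (a : ι) {w : Fin 3 → E} (hw : Orthonormal ℝ w)
    (hwv : ∀ i b, b ≠ a → inner ℝ (w i) (v b) = 0) (hwa : ∀ i, inner ℝ (w i) (v a) ≠ 0) :
    (gram ℝ v)⁻¹ a a ≤ ∏ i, |inner ℝ (w i) (v a)| ^ (-(2 / 3) : ℝ) := by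
  set t : Fin 3 → ℝ := fun i => inner ℝ (w i) (v a) with ht
  set s := ∑ i, t i ^ 2 with hs
  have hu := inv_gram_apply_mul_sq_le v a (u := ∑ i, t i • w i) (fun b hb => by
    simp [sum_inner, inner_smul_left, hwv _ b hb])
  have h1 : inner ℝ (∑ i, t i • w i) (v a) = s := by
    simp [sum_inner, inner_smul_left, hs, ht, sq]
  have h2 : ‖∑ i, t i • w i‖ ^ 2 = s := by
    rw [← real_inner_self_eq_norm_sq, hw.inner_sum]
    simp [hs, sq]
  have hspos : 0 < s := Finset.sum_pos (fun i _ => by have := hwa i; positivity) (by simp)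
  rw [h1, h2] at hu
  have h3 : (gram ℝ v)⁻¹ a a ≤ s⁻¹ := by
    refine (le_div_iff₀ hspos).2 (le_of_mul_le_mul_right ?_ hspos) |>.trans_eq (one_div s)
    linarith
  have h4 : ∏ i, |t i| ^ (2 / 3 : ℝ) ≤ s := by
    calc ∏ i, |t i| ^ (2 / 3 : ℝ) = ∏ i, (t i ^ 2) ^ (1 / 3 : ℝ) := by
          refine Finset.prod_congr rfl fun i _ => ?_
          rw [← sq_abs, ← Real.rpow_natCast_mul (abs_nonneg _)]
          norm_num
      _ ≤ ∑ i, (1 / 3 : ℝ) * t i ^ 2 :=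
          Real.geom_mean_le_arith_mean_weighted _ _ _ (by simp) (by simp)
            fun i _ => sq_nonneg _
      _ ≤ s := Finset.sum_le_sum fun i _ => by nlinarith [sq_nonneg (t i)]
  refine h3.trans ?_
  simp_rw [Real.rpow_neg (abs_nonneg _), Finset.prod_inv_distrib]
  exact inv_anti₀ (Finset.prod_pos fun i _ => Real.rpow_pos_of_pos (abs_pos.2 (hwa i)) _) h4

theorem ae_linearIndependent_pi_stdGaussian {E : Type*} [NormedAddCommGroup E]
    [InnerProductSpace ℝ E] [FiniteDimensional ℝ E] [MeasurableSpace E] [BorelSpace E] :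
    ∀ {m : ℕ}, m ≤ Module.finrank ℝ E →
      ∀ᵐ v ∂(Measure.pi fun _ : Fin m => stdGaussian E), LinearIndependent ℝ v
  | 0, _ => .of_forall fun _ => linearIndependent_empty_type
  | m + 1, hm => by
    have ih := ae_linearIndependent_pi_stdGaussian (E := E) (m := m) (by omega)
    have hmp := (measurePreserving_piFinSuccAbove (fun _ : Fin (m + 1) => stdGaussian E) 0).symm
    have hmeas : MeasurableSet {v : Fin (m + 1) → E | LinearIndependent ℝ v} :=
      isOpen_setOfPred_linearIndependent.measurableSet
    rw [← hmp.map_eq, ae_map_iff hmp.measurable.aemeasurable hmeas,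
      ← (Measure.measurePreserving_swap).map_eq]
    refine (ae_map_iff (by fun_prop) (hmp.measurable hmeas)).2
      ((Measure.ae_prod_iff_ae_ae (measurable_swap (hmp.measurable hmeas))).2 ?_)
    filter_upwards [ih] with y hy
    obtain ⟨w, hw, hwy⟩ := exists_orthonormal_of_finrank_add_le (k := 1) y (by simpa using hm)
    filter_upwards [ae_inner_ne_zero_stdGaussian (hw.ne_zero 0)] with x hx
    change LinearIndependent ℝ (Fin.insertNth 0 x y)
    rw [Fin.insertNth_zero', linearIndependent_finCons]
    refine ⟨hy, fun hxy => hx ?_⟩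
    refine Submodule.span_induction (p := fun z _ => inner ℝ (w 0) z = 0) ?_ ?_ ?_ ?_ hxy
    · rintro _ ⟨j, rfl⟩
      exact hwy 0 j
    · simp
    · intro a b _ _ ha hb
      rw [inner_add_right, ha, hb, add_zero]
    · intro c a _ ha
      rw [inner_smul_right, ha, mul_zero]

theorem measurable_matrix_det {α ι : Type*} [MeasurableSpace α] [Fintype ι] [DecidableEq ι]
    {M : α → Matrix ι ι ℝ} (hM : ∀ i j, Measurable fun x => M x i j) :
    Measurable fun x => (M x).det := by
  simp_rw [det_apply']
  fun_prop

theorem measurable_matrix_inv_apply {α ι : Type*} [MeasurableSpace α] [Fintype ι] [DecidableEq ι]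
    {M : α → Matrix ι ι ℝ} (hM : ∀ i j, Measurable fun x => M x i j) (a b : ι) :
    Measurable fun x => (M x)⁻¹ a b := by
  simp_rw [inv_def, Matrix.smul_apply, Ring.inverse_eq_inv', smul_eq_mul, adjugate_apply]
  refine (measurable_matrix_det hM).inv.mul (measurable_matrix_det fun i j => ?_)
  by_cases h : i = b
  · subst h
    simp
  · simpa [updateRow_ne h] using hM i j

theorem measurable_inv_gram_apply {E ι : Type*} [NormedAddCommGroup E] [InnerProductSpace ℝ E]
    [FiniteDimensional ℝ E] [MeasurableSpace E] [BorelSpace E] [Fintype ι] [DecidableEq ι]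
    (a b : ι) : Measurable fun v : ι → E => (gram ℝ v)⁻¹ a b := by
  refine measurable_matrix_inv_apply (fun i j => ?_) a b
  simp only [gram_apply]
  fun_prop

theorem lintegral_inv_gram_apply_le {E : Type*} [NormedAddCommGroup E]
    [InnerProductSpace ℝ E] [FiniteDimensional ℝ E] [MeasurableSpace E] [BorelSpace E]
    {d : ℕ} (hd : d + 2 ≤ Module.finrank ℝ E) (a : Fin d) :
    ∫⁻ v, ENNReal.ofReal ((gram ℝ v)⁻¹ a a) ∂(Measure.pi fun _ : Fin d => stdGaussian E)
      ≤ ∫⁻ y : Fin 3 → ℝ, ENNReal.ofReal (∏ i, |y i| ^ (-(2 / 3) : ℝ))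
          ∂(Measure.pi fun _ => gaussianReal 0 1) := by
  obtain _ | m := d
  · exact a.elim0
  have hmp := (measurePreserving_piFinSuccAbove (fun _ : Fin (m + 1) => stdGaussian E) a).symm
  have hmeas : Measurable fun v : Fin (m + 1) → E => ENNReal.ofReal ((gram ℝ v)⁻¹ a a) :=
    (measurable_inv_gram_apply a a).ennreal_ofReal
  rw [← hmp.lintegral_comp hmeas,
    lintegral_prod_symm' (fun z => ENNReal.ofReal ((gram ℝ _)⁻¹ a a))
      (hmeas.comp hmp.measurable)]
  refine (lintegral_mono fun y => ?_).trans_eq (by rw [lintegral_const, measure_univ, mul_one])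
  obtain ⟨w, hw, hwy⟩ := exists_orthonormal_of_finrank_add_le (k := 3) y (by simpa using hd)
  rw [← map_inner_stdGaussian hw, lintegral_map (by fun_prop) (by fun_prop)]
  refine lintegral_mono_ae ?_
  filter_upwards [ae_all_iff.2 fun i => ae_inner_ne_zero_stdGaussian (hw.ne_zero i)] with x hx
  refine ENNReal.ofReal_le_ofReal ?_
  change (gram ℝ (Fin.insertNth a x y : Fin (m + 1) → E))⁻¹ a a ≤ _
  refine (inv_gram_apply_le_prod _ a hw (fun i b hb => ?_) (by simpa using hx)).trans_eq
    (by simp)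
  obtain ⟨j, rfl⟩ := Fin.exists_succAbove_eq hb
  simpa using hwy i j

section LeftPseudoInverse

variable {ι κ : Type*} [Fintype ι] [Fintype κ] [DecidableEq κ]

/-- The left pseudo-inverse `(AᵀA)⁻¹Aᵀ` of a matrix of full column rank. -/
noncomputable def leftPinv (A : Matrix ι κ ℝ) : Matrix κ ι ℝ := (Aᵀ * A)⁻¹ * Aᵀ

theorem leftPinv_apply_sq_le (A : Matrix ι κ ℝ) (a : κ) (i : ι) :
    leftPinv A a i ^ 2 ≤ (Aᵀ * A)⁻¹ a a := by
  have h : leftPinv A * (leftPinv A)ᵀ = (Aᵀ * A)⁻¹ := by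
    have hs : (Aᵀ * A)ᵀ = Aᵀ * A := by simp
    rw [leftPinv, transpose_mul, transpose_nonsing_inv, hs, transpose_transpose]
    by_cases hdet : IsUnit (Aᵀ * A).det
    · rw [Matrix.mul_assoc, ← Matrix.mul_assoc Aᵀ, mul_nonsing_inv _ hdet, Matrix.mul_one]
    · simp [nonsing_inv_apply_not_isUnit _ hdet]
  rw [← h, mul_apply]
  simp_rw [transpose_apply, ← sq]
  exact Finset.single_le_sum (f := fun j => leftPinv A a j ^ 2) (fun j _ => sq_nonneg _)
    (Finset.mem_univ i)

theorem leftPinv_mul_of_orthogonal [DecidableEq ι] {Q : Matrix ι ι ℝ} (hQ : Qᵀ * Q = 1)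
    (A : Matrix ι κ ℝ) : leftPinv (Q * A) = leftPinv A * Qᵀ := by
  rw [leftPinv, leftPinv, transpose_mul, Matrix.mul_assoc Aᵀ, ← Matrix.mul_assoc Qᵀ, hQ,
    Matrix.one_mul, Matrix.mul_assoc]

theorem leftPinv_mul_self {A : Matrix ι κ ℝ} (hA : IsUnit (Aᵀ * A).det) : leftPinv A * A = 1 := by
  rw [leftPinv, Matrix.mul_assoc, nonsing_inv_mul _ hA]

theorem measurable_leftPinv_apply (a : κ) (i : ι) :
    Measurable fun A : ι → κ → ℝ => leftPinv (of A) a i := by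
  simp_rw [leftPinv, mul_apply (N := (of _)ᵀ), transpose_apply, of_apply]
  refine Finset.measurable_sum _ fun j _ =>
    (measurable_matrix_inv_apply (fun k l => ?_) a j).mul (by fun_prop)
  simp_rw [mul_apply, transpose_apply, of_apply]
  fun_prop

end LeftPseudoInverse

theorem transpose_mul_self_eq_gram {ι κ : Type*} [Fintype ι] (A : Matrix ι κ ℝ) :
    Aᵀ * A = gram ℝ fun j => (WithLp.toLp 2 fun i => A i j : EuclideanSpace ℝ ι) := by
  ext a b
  simp [mul_apply, gram_apply, PiLp.inner_apply, mul_comm]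

/-- The law of an `n × d` matrix with independent standard normal entries. -/
noncomputable def gaussianMatrix (n d : ℕ) : Measure (Fin n → Fin d → ℝ) :=
  Measure.pi fun _ => Measure.pi fun _ => gaussianReal 0 1

instance (n d : ℕ) : IsProbabilityMeasure (gaussianMatrix n d) := by
  unfold gaussianMatrix
  infer_instance

theorem ae_isUnit_det_gaussianMatrix {n d : ℕ} (h : d ≤ n) :
    ∀ᵐ A ∂(gaussianMatrix n d), IsUnit ((of A)ᵀ * of A).det := by
  have h1 := ae_linearIndependent_pi_stdGaussian (E := EuclideanSpace ℝ (Fin n)) (m := d)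
    (by simpa using h)
  rw [← map_toLp_col] at h1
  filter_upwards [ae_of_ae_map (Measurable.aemeasurable (by fun_prop)) h1] with A hA
  rw [transpose_mul_self_eq_gram, isUnit_iff_ne_zero]
  exact det_gram_ne_zero_iff_linearIndependent.2 hA

theorem memLp_leftPinv_gaussianMatrix {n d : ℕ} (h : d + 2 ≤ n) (a : Fin d) (i : Fin n) :
    MemLp (fun A => leftPinv (of A) a i) 2 (gaussianMatrix n d) := by
  have hm := measurable_leftPinv_apply a i
  rw [memLp_two_iff_integrable_sq hm.aestronglyMeasurable]
  refine ⟨(hm.pow_const 2).aestronglyMeasurable, ?_⟩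
  rw [hasFiniteIntegral_iff_ofReal (.of_forall fun _ => sq_nonneg _)]
  refine lt_of_le_of_lt ?_ lintegral_prod_abs_rpow_lt_top
  refine le_trans ?_ (lintegral_inv_gram_apply_le (E := EuclideanSpace ℝ (Fin n))
    (by simpa using h) a)
  rw [← map_toLp_col,
    lintegral_map (measurable_inv_gram_apply a a).ennreal_ofReal (by fun_prop)]
  refine lintegral_mono fun A => ENNReal.ofReal_le_ofReal ?_
  exact (leftPinv_apply_sq_le (of A) a i).trans_eq
    (by rw [transpose_mul_self_eq_gram]; simp)

theorem memLp_apply_gaussianMatrix {n d : ℕ} (i : Fin n) (b : Fin d) :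
    MemLp (fun A => A i b) 2 (gaussianMatrix n d) := by
  have h1 := measurePreserving_eval
    (fun _ : Fin n => Measure.pi fun _ : Fin d => gaussianReal 0 1) i
  have h2 := measurePreserving_eval (fun _ : Fin d => gaussianReal 0 1) b
  exact (memLp_id_gaussianReal 2).comp_measurePreserving (h2.comp h1)

theorem integrable_leftPinv_mul {n d : ℕ} (h : d + 2 ≤ n) (a b : Fin d) (i j : Fin n) :
    Integrable (fun A => leftPinv (of A) a i * A j b) (gaussianMatrix n d) :=
  (memLp_leftPinv_gaussianMatrix h a i).integrable_mul (memLp_apply_gaussianMatrix j b)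

theorem measurePreserving_row_perm {n d : ℕ} (σ : Equiv.Perm (Fin n)) :
    MeasurePreserving (fun A i => A (σ i)) (gaussianMatrix n d) (gaussianMatrix n d) := by
  convert! measurePreserving_piCongrLeft
    (fun _ : Fin n => Measure.pi fun _ : Fin d => gaussianReal 0 1) σ.symm using 1
  ext A i b
  simp [MeasurableEquiv.piCongrLeft, Equiv.piCongrLeft, Equiv.piCongrLeft']

theorem measurePreserving_row_neg {n d : ℕ} (k : Fin n) :
    MeasurePreserving (fun A i b => if i = k then -A i b else A i b)
      (gaussianMatrix n d) (gaussianMatrix n d) := by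
  have hneg : MeasurePreserving (fun x : ℝ => -x) (gaussianReal 0 1) (gaussianReal 0 1) :=
    ⟨by fun_prop, by simpa using gaussianReal_map_neg (μ := 0) (v := 1)⟩
  refine measurePreserving_pi _ _ (f := fun i (x : Fin d → ℝ) b => if i = k then -x b else x b)
    fun i => ?_
  refine measurePreserving_pi _ _ (f := fun _ (x : ℝ) => if i = k then -x else x) fun _ => ?_
  split_ifs
  · exact hneg
  · exact .id _

theorem integral_leftPinv_mul_of_ne {n d : ℕ} (a b : Fin d) {i j : Fin n} (hij : i ≠ j) :
    ∫ A, leftPinv (of A) a i * A j b ∂(gaussianMatrix n d) = 0 := by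
  set D : Matrix (Fin n) (Fin n) ℝ := diagonal fun k => if k = i then -1 else 1 with hD
  have hDD : Dᵀ * D = 1 := by
    rw [hD, diagonal_transpose, diagonal_mul_diagonal, ← diagonal_one]
    congr 1
    ext k
    split_ifs <;> simp
  have h : ∀ A : Fin n → Fin d → ℝ,
      leftPinv (of fun k c => if k = i then -A k c else A k c) a i = -leftPinv (of A) a i := by
    intro A
    have : (of fun k c => if k = i then -A k c else A k c) = D * of A := by
      ext k c
      rw [hD, diagonal_mul]
      split_ifs <;> simp [*]
    rw [this, leftPinv_mul_of_orthogonal hDD, hD, diagonal_transpose, mul_diagonal]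
    simp
  have hmp := measurePreserving_row_neg (d := d) i
  have hm : Measurable fun A : Fin n → Fin d → ℝ => leftPinv (of A) a i * A j b :=
    (measurable_leftPinv_apply a i).mul (by fun_prop)
  have key := integral_map (μ := gaussianMatrix n d) hmp.aemeasurable
    (f := fun A => leftPinv (of A) a i * A j b) hm.aestronglyMeasurable
  rw [hmp.map_eq] at key
  simp only [h, if_neg hij.symm, neg_mul, integral_neg] at key
  linarith

theorem integral_leftPinv_mul_eq {n d : ℕ} (a b : Fin d) (i j : Fin n) :
    ∫ A, leftPinv (of A) a i * A i b ∂(gaussianMatrix n d)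
      = ∫ A, leftPinv (of A) a j * A j b ∂(gaussianMatrix n d) := by
  set σ := Equiv.swap i j with hσ
  set Q : Matrix (Fin n) (Fin n) ℝ := (1 : Matrix (Fin n) (Fin n) ℝ).submatrix σ id with hQ
  have hQQ : Qᵀ * Q = 1 := by
    rw [hQ, transpose_submatrix, submatrix_mul_equiv]
    simp
  have h : ∀ A : Fin n → Fin d → ℝ,
      leftPinv (of fun k => A (σ k)) a i = leftPinv (of A) a j := by
    intro A
    have : (of fun k => A (σ k)) = Q * of A := by
      ext k c
      simp [hQ, mul_apply, one_apply]
    rw [this, leftPinv_mul_of_orthogonal hQQ]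
    simp [hQ, mul_apply, one_apply, hσ]
  have hmp := measurePreserving_row_perm (d := d) σ
  have hm : Measurable fun A : Fin n → Fin d → ℝ => leftPinv (of A) a i * A i b :=
    (measurable_leftPinv_apply a i).mul (by fun_prop)
  have key := integral_map (μ := gaussianMatrix n d) hmp.aemeasurable
    (f := fun A => leftPinv (of A) a i * A i b) hm.aestronglyMeasurable
  rw [hmp.map_eq] at key
  simp only [h] at key
  simpa only [hσ, Equiv.swap_apply_left] using key

theorem inv_mul_vecMulVec_apply {ι κ : Type*} [Fintype ι] [Fintype κ] [DecidableEq κ]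
    (A : Matrix ι κ ℝ) (a b : κ) :
    ((Aᵀ * A)⁻¹ * vecMulVec (Aᵀ.mulVec fun _ => (1 : ℝ)) (Aᵀ.mulVec fun _ => (1 : ℝ))) a b
      = ∑ i, ∑ j, leftPinv A a i * A j b := by
  rw [mul_vecMulVec, mulVec_mulVec, vecMulVec_apply, ← Finset.sum_mul_sum, leftPinv]
  simp [mulVec, dotProduct]

theorem integrable_inv_mul_vecMulVec {n d : ℕ} (h : d + 2 ≤ n) (a b : Fin d) :
    Integrable (fun A => (((of A)ᵀ * of A)⁻¹ * vecMulVec ((of A)ᵀ.mulVec fun _ => (1 : ℝ))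
      ((of A)ᵀ.mulVec fun _ => (1 : ℝ))) a b) (gaussianMatrix n d) := by
  simp_rw [inv_mul_vecMulVec_apply]
  exact integrable_finsetSum _ fun i _ => integrable_finsetSum _ fun j _ =>
    integrable_leftPinv_mul h a b i j

theorem integral_inv_mul_vecMulVec {n d : ℕ} (h : d + 2 ≤ n) (a b : Fin d) :
    ∫ A, (((of A)ᵀ * of A)⁻¹ * vecMulVec ((of A)ᵀ.mulVec fun _ => (1 : ℝ))
      ((of A)ᵀ.mulVec fun _ => (1 : ℝ))) a b ∂(gaussianMatrix n d)
      = (1 : Matrix (Fin d) (Fin d) ℝ) a b := by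
  have hint := integrable_leftPinv_mul h a b
  simp_rw [inv_mul_vecMulVec_apply]
  calc ∫ A, ∑ i, ∑ j, leftPinv (of A) a i * A j b ∂(gaussianMatrix n d)
      = ∑ i, ∑ j, ∫ A, leftPinv (of A) a i * A j b ∂(gaussianMatrix n d) := by
        rw [integral_finsetSum _ fun i _ => integrable_finsetSum _ fun j _ => hint i j]
        exact Finset.sum_congr rfl fun i _ => integral_finsetSum _ fun j _ => hint i j
    _ = ∑ i, ∫ A, leftPinv (of A) a i * A i b ∂(gaussianMatrix n d) :=
        Finset.sum_congr rfl fun i _ => Finset.sum_eq_single i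
          (fun j _ hj => integral_leftPinv_mul_of_ne a b hj.symm) (by simp)
    _ = ∫ A, (leftPinv (of A) * of A) a b ∂(gaussianMatrix n d) := by
        rw [← integral_finsetSum _ fun i _ => hint i i]
        rfl
    _ = ∫ A, (1 : Matrix (Fin d) (Fin d) ℝ) a b ∂(gaussianMatrix n d) := by
        refine integral_congr_ae ?_
        filter_upwards [ae_isUnit_det_gaussianMatrix (by omega : d ≤ n)] with A hA
        rw [leftPinv_mul_self hA]
    _ = _ := by simp

/-- for an `n×d` matrix `X` with independent `N(0,1)` entries and
`n ≥ d+2 ≥ 3`, `XᵀX` is a.s. invertible, `(XᵀX)⁻¹(Xᵀ𝟙)(Xᵀ𝟙)ᵀ` is integrable with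
`E[(XᵀX)⁻¹(Xᵀ𝟙)(Xᵀ𝟙)ᵀ] = I_d`; equivalently
`E[(XᵀX)⁻¹Xᵀ(𝟙𝟙ᵀ/n)Xβ] = β/n` for every `β ∈ ℝ^d`. -/
theorem expected_inverse_gram_ones (n d : ℕ) (hd : 1 ≤ d) (hnd : d + 2 ≤ n)
    (Ω : Type*) [MeasureSpace Ω] [IsProbabilityMeasure (ℙ : Measure Ω)]
    (X : Ω → Fin n → Fin d → ℝ) (hXm : Measurable X)
    -- the entries of X are independent N(0,1)
    (hX : Measure.map X ℙ
      = Measure.pi fun _ : Fin n => Measure.pi fun _ : Fin d => gaussianReal 0 1) :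
    (∀ᵐ ω ∂ℙ, IsUnit ((Matrix.of (X ω))ᵀ * Matrix.of (X ω)).det) ∧
    (∀ a b : Fin d,
      Integrable (fun ω =>
        (((Matrix.of (X ω))ᵀ * Matrix.of (X ω))⁻¹ *
          Matrix.vecMulVec ((Matrix.of (X ω))ᵀ.mulVec fun _ => (1 : ℝ))
            ((Matrix.of (X ω))ᵀ.mulVec fun _ => (1 : ℝ))) a b) ℙ) ∧
    (∀ a b : Fin d,
      ∫ ω, (((Matrix.of (X ω))ᵀ * Matrix.of (X ω))⁻¹ *
          Matrix.vecMulVec ((Matrix.of (X ω))ᵀ.mulVec fun _ => (1 : ℝ))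
            ((Matrix.of (X ω))ᵀ.mulVec fun _ => (1 : ℝ))) a b ∂ℙ
        = (1 : Matrix (Fin d) (Fin d) ℝ) a b) ∧
    (∀ β : Fin d → ℝ,
      ∫ ω, (((Matrix.of (X ω))ᵀ * Matrix.of (X ω))⁻¹ * (Matrix.of (X ω))ᵀ *
          ((n : ℝ)⁻¹ • Matrix.of fun (_ : Fin n) (_ : Fin n) => (1 : ℝ)) *
          Matrix.of (X ω)).mulVec β ∂ℙ
        = (n : ℝ)⁻¹ • β) := by
  have hae : AEMeasurable X ℙ := hXm.aemeasurable
  have hmp : MeasurePreserving X ℙ (gaussianMatrix n d) := ⟨hXm, hX⟩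
  have hint : ∀ a b : Fin d, Integrable (fun ω => (((of (X ω))ᵀ * of (X ω))⁻¹ *
      vecMulVec ((of (X ω))ᵀ.mulVec fun _ => (1 : ℝ)) ((of (X ω))ᵀ.mulVec fun _ => (1 : ℝ))) a b) ℙ :=
    fun a b => hmp.integrable_comp_of_integrable (integrable_inv_mul_vecMulVec hnd a b)
  have hval : ∀ a b : Fin d, _ = (1 : Matrix (Fin d) (Fin d) ℝ) a b := fun a b =>
    (integral_map hae (hmp.map_eq.symm ▸ (integrable_inv_mul_vecMulVec hnd a b).1)).symm.trans
      (hmp.map_eq.symm ▸ integral_inv_mul_vecMulVec hnd a b)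
  refine ⟨hmp.quasiMeasurePreserving.ae (ae_isUnit_det_gaussianMatrix (by omega)), hint, hval,
    fun β => ?_⟩
  have hform : ∀ (A : Matrix (Fin n) (Fin d) ℝ) (a : Fin d),
      ((Aᵀ * A)⁻¹ * Aᵀ * ((n : ℝ)⁻¹ • of fun (_ : Fin n) (_ : Fin n) => (1 : ℝ)) * A).mulVec β a
        = ∑ b, ((n : ℝ)⁻¹ * β b) * ((Aᵀ * A)⁻¹ * vecMulVec (Aᵀ.mulVec fun _ => (1 : ℝ))
          (Aᵀ.mulVec fun _ => (1 : ℝ))) a b := by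
    intro A a
    have hone : (of fun (_ : Fin n) (_ : Fin n) => (1 : ℝ))
        = vecMulVec (fun _ => (1 : ℝ)) (fun _ => (1 : ℝ)) := by
      ext
      simp [vecMulVec_apply]
    rw [hone, mul_vecMulVec, mulVec_mulVec, Matrix.mul_smul, Matrix.smul_mul, mul_vecMulVec,
      vecMulVec_mul, mulVec_transpose]
    simp only [mulVec, dotProduct, Matrix.smul_apply, smul_eq_mul]
    exact Finset.sum_congr rfl fun b _ => by ring
  ext a
  rw [eval_integral]
  · simp_rw [hform]
    rw [integral_finsetSum _ fun b _ => (hint a b).const_mul _]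
    simp_rw [integral_const_mul, hval]
    simp [one_apply]
  · intro a
    simp_rw [hform]
    exact integrable_finsetSum _ fun b _ => (hint a b).const_mul _
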